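/- arXiv:2605.27682 — 6 statements merged into one kernel-verified Lean document; each statement's English description precedes it below -/
import Mathlib

section
/- Let A, B ∈ ℝ^{n×m} and let k be a positive integer with k < rank(A). If C_k(A) = C_k(B), then A = B when k is odd, and A = B or A = −B when k is even. -/
/-- The `k`-th multiplicative compound of a matrix `A : ℝ^{n×m}`: the matrix indexed by
`k`-element subsets `I ⊆ {1,…,n}`, `J ⊆ {1,…,m}` whose `(I,J)` entry is `det(A_{I,J})`,
the submatrix being taken with rows and columns in increasing order. -/
def compound {n m : ℕ} (k : ℕ) (A : Matrix (Fin n) (Fin m) ℝ) :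
    Matrix {s : Finset (Fin n) // s.card = k} {t : Finset (Fin m) // t.card = k} ℝ :=
  fun I J => Matrix.det (Matrix.of fun a b : Fin k =>
    A (I.1.orderEmbOfFin I.2 a) (J.1.orderEmbOfFin J.2 b))

open Matrix in
theorem minors_eq {n m k : ℕ} {A B : Matrix (Fin n) (Fin m) ℝ} (h : compound k A = compound k B)
    (f : Fin k → Fin n) (g : Fin k → Fin m) (hf : f.Injective) (hg : g.Injective) :
    (A.submatrix f g).det = (B.submatrix f g).det := by
  have key : ∀ {n : ℕ} (f : Fin k → Fin n), f.Injective →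
      ∃ (I : {s : Finset (Fin n) // s.card = k}) (σ : Equiv.Perm (Fin k)),
        f = (I.1.orderEmbOfFin I.2) ∘ σ := by
    intro n f hf
    have hc : (Finset.univ.image f).card = k := by
      rw [Finset.card_image_of_injective _ hf]; simp
    have hx : ∀ i, ∃ j, (Finset.univ.image f).orderEmbOfFin hc j = f i := by
      intro i
      have : f i ∈ Set.range ((Finset.univ.image f).orderEmbOfFin hc) := by
        rw [Finset.range_orderEmbOfFin]; simp
      exact this
    choose s hs using hx
    have hsi : s.Injective := fun a b hab => hf (by rw [← hs a, ← hs b, hab])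
    refine ⟨⟨_, hc⟩, Equiv.ofBijective s (Finite.injective_iff_bijective.1 hsi), ?_⟩
    funext i
    exact (hs i).symm
  obtain ⟨I, σ, rfl⟩ := key f hf
  obtain ⟨J, τ, rfl⟩ := key g hg
  have e : ∀ C : Matrix (Fin n) (Fin m) ℝ,
      (C.submatrix ((I.1.orderEmbOfFin I.2) ∘ σ) ((J.1.orderEmbOfFin J.2) ∘ τ)).det
        = Equiv.Perm.sign σ * (Equiv.Perm.sign τ * compound k C I J) := by
    intro C
    have h1 := det_permute σ ((C.submatrix (I.1.orderEmbOfFin I.2) (J.1.orderEmbOfFin J.2)).submatrix id τ)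
    rw [det_permute'] at h1
    exact h1
  rw [e, e, h]

open Matrix in
theorem left_mul_eq {n k : ℕ} {A B : Matrix (Fin n) (Fin k) ℝ}
    (h : ∀ f : Fin k → Fin n, f.Injective → (A.submatrix f id).det = (B.submatrix f id).det)
    (P : Matrix (Fin k) (Fin n) ℝ) : (P * A).det = (P * B).det := by
  have : (detRowAlternating (n := Fin k) (R := ℝ)).compLinearMap A.vecMulLinear
      = (detRowAlternating (n := Fin k) (R := ℝ)).compLinearMap B.vecMulLinear := by
    refine Module.Basis.ext_alternating (Pi.basisFun ℝ (Fin n)) fun v hv => ?_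
    have e : ∀ C : Matrix (Fin n) (Fin k) ℝ,
        ((detRowAlternating (n := Fin k) (R := ℝ)).compLinearMap C.vecMulLinear)
          (fun i => Pi.basisFun ℝ (Fin n) (v i)) = (C.submatrix v id).det := by
      intro C
      rw [AlternatingMap.compLinearMap_apply]
      change det _ = det _
      congr 1
      ext i j
      simp
    rw [e, e, h v hv]
  exact congrArg (fun F => F (fun i => P i)) this

open Matrix in
theorem both_mul_eq {n m k : ℕ} {A B : Matrix (Fin n) (Fin m) ℝ} (h : compound k A = compound k B)
    (P : Matrix (Fin k) (Fin n) ℝ) (Q : Matrix (Fin m) (Fin k) ℝ) :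
    (P * A * Q).det = (P * B * Q).det := by
  rw [Matrix.mul_assoc, Matrix.mul_assoc]
  apply left_mul_eq
  intro f hf
  have e : ∀ C : Matrix (Fin n) (Fin m) ℝ,
      ((C * Q).submatrix f id).det = (Qᵀ * (C.submatrix f id)ᵀ).det := by
    intro C
    rw [← Matrix.transpose_mul, det_transpose]
    rfl
  rw [e, e]
  apply left_mul_eq
  intro g hg
  have := minors_eq h f g hf hg
  rw [← det_transpose, ← det_transpose (B.submatrix f g)] at this
  exact this

open Matrix in
theorem scalar_of_adj {k : ℕ} {M N : Matrix (Fin (k+1)) (Fin (k+1)) ℝ}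
    (h : M.adjugate = N.adjugate) (hM : M.det ≠ 0) : ∃ c : ℝ, c ^ k = 1 ∧ N = c • M := by
  have hd := congrArg det h
  rw [det_adjugate, det_adjugate, Fintype.card_fin, Nat.add_sub_cancel] at hd
  refine ⟨N.det / M.det, ?_, ?_⟩
  · rw [div_pow, ← hd, div_self (pow_ne_zero _ hM)]
  · have h1 : M.det • N = N.det • M := by
      calc M.det • N = (M * M.adjugate) * N := by rw [mul_adjugate]; simp
        _ = M * (N.adjugate * N) := by rw [h, Matrix.mul_assoc]
        _ = N.det • M := by rw [adjugate_mul]; simp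
    rw [div_eq_inv_mul, mul_smul, ← h1, smul_smul, inv_mul_cancel₀ hM, one_smul]

/-- All bilinear `k`-minors agree. -/
def SameMinors {n m : ℕ} (k : ℕ) (A B : Matrix (Fin n) (Fin m) ℝ) : Prop :=
  ∀ (P : Matrix (Fin k) (Fin n) ℝ) (Q : Matrix (Fin m) (Fin k) ℝ),
    (P * A * Q).det = (P * B * Q).det

open Matrix in
theorem SameMinors.transpose {n m k : ℕ} {A B : Matrix (Fin n) (Fin m) ℝ}
    (h : SameMinors k A B) : SameMinors k Aᵀ Bᵀ := by
  intro P Q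
  have := h Qᵀ Pᵀ
  rw [← det_transpose, ← det_transpose (Qᵀ * B * Pᵀ)] at this
  simpa [Matrix.mul_assoc] using this

open Matrix in
theorem SameMinors.scalar {n m k : ℕ} {A B : Matrix (Fin n) (Fin m) ℝ}
    (h : SameMinors k A B) (X : Matrix (Fin (k+1)) (Fin n) ℝ) (Y : Matrix (Fin m) (Fin (k+1)) ℝ)
    (hd : (X * A * Y).det ≠ 0) : ∃ c : ℝ, c ^ k = 1 ∧ X * B * Y = c • (X * A * Y) := by
  refine scalar_of_adj ?_ hd
  ext i j
  rw [adjugate_fin_succ_eq_det_submatrix, adjugate_fin_succ_eq_det_submatrix]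
  congr 1
  exact h (X.submatrix j.succAbove id) (Y.submatrix id i.succAbove)

open Matrix in
theorem exists_sign_col {k : ℕ} (M : Matrix (Fin (k+1)) (Fin (k+1)) ℝ) (hM : M.det ≠ 0)
    (u : Fin (k+1) → ℝ) : ∃ t : ℝ, t ≠ 0 ∧ (M.updateCol 0 (Mᵀ 0 + t • u)).det ≠ 0 := by
  by_contra! hc
  have h1 := hc 1 one_ne_zero
  have h2 := hc (-1) (by norm_num)
  rw [det_updateCol_add, det_updateCol_smul] at h1 h2
  have h3 : M.updateCol 0 (Mᵀ 0) = M := by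
    ext i j
    by_cases hj : j = 0
    · subst hj; simp
    · simp [hj]
  rw [h3] at h1 h2
  apply hM
  linarith

open Matrix in
theorem SameMinors.left {n m k : ℕ} {A B : Matrix (Fin n) (Fin m) ℝ} (hk : 0 < k)
    (h : SameMinors k A B) (X : Matrix (Fin (k+1)) (Fin n) ℝ) (Y : Matrix (Fin m) (Fin (k+1)) ℝ)
    (hd : (X * A * Y).det ≠ 0) (he : X * B * Y = X * A * Y) : X * B = X * A := by
  suffices hs : ∀ y : Fin m → ℝ, (X * B) *ᵥ y = (X * A) *ᵥ y by
    ext i j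
    have := congrFun (hs (Pi.single j 1)) i
    simpa using this
  intro y
  obtain ⟨t, ht, htd⟩ := exists_sign_col _ hd ((X * A) *ᵥ y)
  have e : ∀ C : Matrix (Fin n) (Fin m) ℝ, X * C * (Y.updateCol 0 (Yᵀ 0 + t • y))
      = (X * C * Y).updateCol 0 ((X * C * Y)ᵀ 0 + t • ((X * C) *ᵥ y)) := by
    intro C
    rw [mul_updateCol, mulVec_add, mulVec_smul]
    rfl
  rw [← e] at htd
  obtain ⟨c, -, hc⟩ := h.scalar X _ htd
  rw [e, e, he] at hc
  have hc1 : c = 1 := by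
    by_contra hne
    apply hd
    have l1 : (1 : Fin (k+1)) ≠ 0 := by
      obtain ⟨k, rfl⟩ : ∃ j, k = j + 1 := ⟨k - 1, by omega⟩
      simp
    apply det_eq_zero_of_column_eq_zero (1 : Fin (k+1))
    intro i
    have := congrFun (congrFun hc i) 1
    simp only [Matrix.smul_apply, updateCol_ne l1, smul_eq_mul] at this
    have h2 : (1 - c) * (X * A * Y) i 1 = 0 := by linarith
    exact (mul_eq_zero.1 h2).resolve_left (fun h => hne (by linarith))
  subst hc1
  funext i
  have := congrFun (congrFun hc i) 0
  simp at this
  exact this.resolve_right ht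

open Matrix in
theorem SameMinors.eq {n m k : ℕ} {A B : Matrix (Fin n) (Fin m) ℝ} (hk : 0 < k)
    (h : SameMinors k A B) (X : Matrix (Fin (k+1)) (Fin n) ℝ) (Y : Matrix (Fin m) (Fin (k+1)) ℝ)
    (hd : (X * A * Y).det ≠ 0) (he : X * B * Y = X * A * Y) : A = B := by
  have hX := h.left hk X Y hd he
  have tr : ∀ C : Matrix (Fin n) (Fin m) ℝ, Yᵀ * Cᵀ * Xᵀ = (X * C * Y)ᵀ := by
    intro C; simp [Matrix.mul_assoc]
  have hd' : (Yᵀ * Aᵀ * Xᵀ).det ≠ 0 := by rwa [tr, det_transpose]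
  have hY := h.transpose.left hk Yᵀ Xᵀ hd' (by rw [tr, tr, he])
  have hY' : B * Y = A * Y := by
    rw [← transpose_mul, ← transpose_mul] at hY
    exact transpose_injective hY
  suffices hs : ∀ x : Fin n → ℝ, x ᵥ* B = x ᵥ* A by
    ext i j
    have := congrFun (hs (Pi.single i 1)) j
    simpa using this.symm
  intro x
  have hd2 : (X * A * Y)ᵀ.det ≠ 0 := by rwa [det_transpose]
  obtain ⟨t, ht, htd⟩ := exists_sign_col _ hd2 (x ᵥ* (A * Y))
  have e : ∀ (l : ℕ) (C : Matrix (Fin n) (Fin l) ℝ), X.updateRow 0 (X 0 + t • x) * C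
      = (X * C).updateRow 0 ((X * C) 0 + t • (x ᵥ* C)) := by
    intro l C
    rw [updateRow_mul, add_vecMul, smul_vecMul]
    rfl
  have hd3 : (X.updateRow 0 (X 0 + t • x) * A * Y).det ≠ 0 := by
    rw [Matrix.mul_assoc, e, ← det_transpose, ← Matrix.mul_assoc, ← updateCol_transpose]
    exact htd
  have h3 := h.left hk _ Y hd3 (by rw [Matrix.mul_assoc, hY', Matrix.mul_assoc])
  rw [e, e, hX] at h3
  funext j
  have := congrFun (congrFun h3 0) j
  simp at this
  exact this.resolve_right ht

open Matrix in
theorem exists_nonsing {n m k : ℕ} (A : Matrix (Fin n) (Fin m) ℝ) (h : k ≤ A.rank) :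
    ∃ (X : Matrix (Fin k) (Fin n) ℝ) (Y : Matrix (Fin m) (Fin k) ℝ), (X * A * Y).det ≠ 0 := by
  obtain ⟨f, hf⟩ := exists_linearIndependent_of_le_finrank (R := ℝ)
    (M := LinearMap.range A.mulVecLin) h
  have hf' := hf.map' (Submodule.subtype _) (Submodule.ker_subtype _)
  choose y hy using fun i => (f i).2
  let Y : Matrix (Fin m) (Fin k) ℝ := Matrix.of fun a i => y i a
  have hc : (A * Y).col = Submodule.subtype _ ∘ f := by
    funext i
    exact hy i
  rw [← hc] at hf'
  have hi : Function.Injective (A * Y).mulVec := mulVec_injective_iff.2 hf'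
  obtain ⟨g, hg⟩ := LinearMap.exists_leftInverse_of_injective (A * Y).mulVecLin
    (LinearMap.ker_eq_bot.2 hi)
  refine ⟨LinearMap.toMatrix' g, Y, ?_⟩
  have : LinearMap.toMatrix' g * (A * Y) = 1 := by
    have := congrArg LinearMap.toMatrix' hg
    rw [LinearMap.toMatrix'_comp, LinearMap.toMatrix'_id] at this
    rw [← this]
    congr 1
    exact (LinearMap.toMatrix'_toLin' _).symm
  rw [Matrix.mul_assoc, this]
  simp

open Matrix in
theorem main_aux {n m k : ℕ} {A B : Matrix (Fin n) (Fin m) ℝ} (hk : 0 < k) (hkr : k < A.rank)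
    (h : compound k A = compound k B) : ∃ c : ℝ, c ^ k = 1 ∧ B = c • A := by
  have hs : SameMinors k A B := both_mul_eq h
  obtain ⟨X, Y, hd⟩ := exists_nonsing (k := k+1) A hkr
  obtain ⟨c, hc, he⟩ := hs.scalar X Y hd
  have hc0 : c ≠ 0 := by
    rintro rfl
    rw [zero_pow hk.ne'] at hc
    exact zero_ne_one hc
  have hs' : SameMinors k A (c⁻¹ • B) := by
    intro P Q
    rw [hs P Q, Matrix.mul_smul, Matrix.smul_mul, det_smul]
    simp [hc]
  have := hs'.eq hk X Y hd (by
    rw [Matrix.mul_smul, Matrix.smul_mul, he, smul_smul, inv_mul_cancel₀ hc0, one_smul])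
  refine ⟨c, hc, ?_⟩
  rw [this, smul_smul, mul_inv_cancel₀ hc0, one_smul]


/-- If `0 < k < rank A` and `C_k(A) = C_k(B)`, then `A = B` when `k` is odd,
and `A = B` or `A = -B` when `k` is even. -/
theorem stmt_0 {n m : ℕ} (A B : Matrix (Fin n) (Fin m) ℝ) (k : ℕ)
    (hk : 0 < k) (hkr : k < A.rank)
    (h : compound k A = compound k B) :
    (Odd k → A = B) ∧ (Even k → A = B ∨ A = -B) := by
  obtain ⟨c, hc, rfl⟩ := main_aux hk hkr h
  constructor
  · intro ho
    have : c = 1 := ho.strictMono_pow.injective (by simpa using hc)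
    simp [this]
  · intro _
    have ha : |c| ^ k = 1 := by rw [← abs_pow, hc, abs_one]
    have : |c| = 1 := (pow_eq_one_iff_of_nonneg (abs_nonneg c) hk.ne').1 ha
    rcases (abs_eq zero_le_one).1 this with h1 | h1
    · left; simp [h1]
    · right; simp [h1]
end

section
/- Let n > 1 and let A, B ∈ ℝ^{n×n} with A invertible. If C_{n−1}(A) = C_{n−1}(B), then A = B when n is even, and A = B or A = −B when n is odd. -/
open Matrix

theorem compound_aux {m : ℕ} (A : Matrix (Fin (m+1)) (Fin (m+1)) ℝ) (i j : Fin (m+1))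
    (hi : (Finset.univ.erase i).card = m) (hj : (Finset.univ.erase j).card = m) :
    compound m A ⟨Finset.univ.erase i, hi⟩ ⟨Finset.univ.erase j, hj⟩
      = det (A.submatrix i.succAbove j.succAbove) := by
  have key : ∀ (i : Fin (m+1)) (hi : (Finset.univ.erase i).card = m),
      i.succAbove = (Finset.univ.erase i).orderEmbOfFin hi := by
    intro i hi
    apply Finset.orderEmbOfFin_unique
    · intro x
      simp [Fin.succAbove_ne]
    · exact Fin.strictMono_succAbove i
  unfold compound
  simp only [key i hi, key j hj]
  rfl

/-- If `n > 1`, `A` is invertible and `C_{n-1}(A) = C_{n-1}(B)`, then `A = B` when `n` is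
even, and `A = B` or `A = -B` when `n` is odd. -/
theorem stmt_3 {n : ℕ} (hn : 1 < n) (A B : Matrix (Fin n) (Fin n) ℝ)
    (hA : IsUnit A.det)
    (h : compound (n - 1) A = compound (n - 1) B) :
    (Even n → A = B) ∧ (Odd n → A = B ∨ A = -B) := by
  obtain ⟨m, rfl⟩ : ∃ m, n = m + 1 := ⟨n - 1, by omega⟩
  have h' : compound m A = compound m B := h
  have hm : m ≠ 0 := by omega
  have hc : ∀ i : Fin (m+1), (Finset.univ.erase i).card = m := by
    intro i
    simp
  have hadj : A.adjugate = B.adjugate := by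
    ext i j
    rw [adjugate_fin_succ_eq_det_submatrix, adjugate_fin_succ_eq_det_submatrix,
      ← compound_aux A j i (hc j) (hc i), ← compound_aux B j i (hc j) (hc i), h']
  have hdet : A.det ^ m = B.det ^ m := by
    have := congrArg det hadj
    simpa [det_adjugate] using this
  have hU : IsUnit A.adjugate := by
    rw [isUnit_iff_isUnit_det, det_adjugate]
    exact hA.pow _
  have hAM := mul_adjugate A
  have hBM := mul_adjugate B
  rw [← hadj] at hBM
  have heq : A.det = B.det → A = B := by
    intro e
    apply hU.mul_right_cancel
    rw [hAM, hBM, e]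
  have hneg : A.det = -B.det → A = -B := by
    intro e
    apply hU.mul_right_cancel
    rw [Matrix.neg_mul, hAM, hBM, e, neg_smul]
  constructor
  · intro he
    have ho : Odd m := by
      rcases Nat.even_or_odd m with h1 | h1
      · exact absurd he (by simpa using h1.add_one)
      · exact h1
    exact heq (ho.pow_injective hdet)
  · intro _
    rcases pow_eq_pow_iff_cases.1 hdet with h1 | h1 | ⟨h1, _⟩
    · exact absurd h1 hm
    · exact Or.inl (heq h1)
    · exact Or.inr (hneg h1)
end

section
/- For every integer n > 1 and every A ∈ ℝ^{n×n}, adj(adj(A)) = C_{n−1}(C_{n−1}(A)), where adj denotes the adjugate matrix. -/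
/-- The `(n-1)`-th multiplicative compound of an `n×n` matrix, written as an `n×n` matrix
with rows and columns indexed in lexicographic order of the `(n-1)`-element subsets of
`{1,…,n}`: the `p`-th subset (0-indexed `p`) is `{1,…,n} ∖ {p.rev}`, i.e. the `(I,J)` entry
is the minor `det(A_{I,J})` with rows `I` and columns `J` taken in increasing order. -/
def compoundPred {n : ℕ} (A : Matrix (Fin n) (Fin n) ℝ) : Matrix (Fin n) (Fin n) ℝ :=
  fun p q => Matrix.det (Matrix.of fun a b : Fin (n - 1) =>
    A ((Finset.univ.erase p.rev).orderEmbOfFin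
        (by simp [Finset.card_erase_of_mem]) a)
      ((Finset.univ.erase q.rev).orderEmbOfFin
        (by simp [Finset.card_erase_of_mem]) b))

theorem cp_apply {m : ℕ} (A : Matrix (Fin (m+1)) (Fin (m+1)) ℝ) (p q : Fin (m+1)) :
    compoundPred A p q
      = (-1) ^ ((p.rev : ℕ) + (q.rev : ℕ)) * A.adjugate q.rev p.rev := by
  have key : ∀ (r : Fin (m+1)) (h : (Finset.univ.erase r).card = m),
      ∀ a, (Finset.univ.erase r).orderEmbOfFin h a = r.succAbove a := by
    intro r h a
    have := Finset.orderEmbOfFin_unique h (f := r.succAbove)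
      (by intro x; simp [Fin.succAbove_ne]) (Fin.strictMono_succAbove r)
    rw [this]
  rw [Matrix.adjugate_fin_succ_eq_det_submatrix, ← mul_assoc, ← mul_pow]
  simp only [neg_mul_neg, mul_one, one_pow, one_mul]
  unfold compoundPred
  congr 1
  ext a b
  exact congrArg₂ A (key _ _ a) (key _ _ b)

theorem cp_eq {m : ℕ} (A : Matrix (Fin (m+1)) (Fin (m+1)) ℝ) :
    compoundPred A = Matrix.diagonal (fun p : Fin (m+1) => (-1 : ℝ) ^ (p.rev : ℕ)) *
      (A.adjugate.transpose.submatrix Fin.revPerm Fin.revPerm) *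
      Matrix.diagonal (fun p : Fin (m+1) => (-1 : ℝ) ^ (p.rev : ℕ)) := by
  ext p q
  rw [cp_apply, Matrix.mul_diagonal, Matrix.diagonal_mul, pow_add]
  simp only [Matrix.submatrix_apply, Matrix.transpose_apply, Fin.revPerm_apply]
  ring

theorem adj_diag {m : ℕ} : ∃ c : ℝ, c * c = 1 ∧
    (Matrix.diagonal (fun p : Fin (m+1) => (-1 : ℝ) ^ (p.rev : ℕ))).adjugate =
      c • Matrix.diagonal (fun p : Fin (m+1) => (-1 : ℝ) ^ (p.rev : ℕ)) := by
  set D := Matrix.diagonal (fun p : Fin (m+1) => (-1 : ℝ) ^ (p.rev : ℕ)) with hD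
  have h1 : D * D = 1 := by
    rw [hD, Matrix.diagonal_mul_diagonal, ← Matrix.diagonal_one]
    congr 1
    ext p
    rw [← mul_pow]; simp
  refine ⟨D.det, ?_, ?_⟩
  · rw [← Matrix.det_mul, h1, Matrix.det_one]
  · calc D.adjugate = D.adjugate * (D * D) := by rw [h1, mul_one]
      _ = _ := by rw [← mul_assoc, Matrix.adjugate_mul, Matrix.smul_mul, one_mul]

theorem cp_adj {m : ℕ} (A : Matrix (Fin (m+1)) (Fin (m+1)) ℝ) (p q : Fin (m+1)) :
    (compoundPred A).adjugate p q
      = (-1) ^ ((p.rev : ℕ) + (q.rev : ℕ)) * A.adjugate.adjugate q.rev p.rev := by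
  obtain ⟨c, hc, h⟩ := adj_diag (m := m)
  rw [cp_eq, Matrix.adjugate_mul_distrib, Matrix.adjugate_mul_distrib, h,
    Matrix.adjugate_submatrix_equiv_self, ← Matrix.adjugate_transpose,
    Matrix.smul_mul, Matrix.mul_smul, Matrix.mul_smul, smul_smul, hc, one_smul,
    Matrix.diagonal_mul, Matrix.mul_diagonal, pow_add]
  simp only [Matrix.submatrix_apply, Matrix.transpose_apply, Fin.revPerm_apply]
  ring

/-- For `n > 1` and `A ∈ ℝ^{n×n}`, `adj(adj(A)) = C_{n-1}(C_{n-1}(A))`. -/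
theorem stmt_7 {n : ℕ} (hn : 1 < n) (A : Matrix (Fin n) (Fin n) ℝ) :
    (A.adjugate).adjugate = compoundPred (compoundPred A) := by
  obtain ⟨m, rfl⟩ : ∃ m, n = m + 1 := ⟨n - 1, by omega⟩
  ext p q
  rw [cp_apply, cp_adj, ← mul_assoc, ← pow_add]
  simp only [Fin.rev_rev]
  have : (p.rev : ℕ) + (q.rev : ℕ) + ((q : ℕ) + (p : ℕ)) = 2 * m := by
    simp only [Fin.val_rev]; omega
  rw [this, pow_mul]; simp
end

section
/- Let M ∈ ℝ^{C(n,k)×C(m,k)} be compound-decomposable, i.e., there exists A ∈ ℝ^{n×m} with C_k(A) = M. Then for Lebesgue-almost every Q ∈ ℝ^{n×n}, the nonzero singular values of C_k(Q)·M are pairwise distinct; equivalently, for almost every Q, every nonzero eigenvalue of the positive semidefinite symmetric matrix (C_k(Q)M)ᵀ(C_k(Q)M) has multiplicity one. -/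
open Matrix MeasureTheory

lemma cauchy_binet_aux {k p : ℕ} (X : Matrix (Fin k) (Fin p) ℝ) (Y : Matrix (Fin p) (Fin k) ℝ) :
    (X * Y).det = ∑ S : {s : Finset (Fin p) // s.card = k},
      (X.submatrix id (S.1.orderEmbOfFin S.2)).det *
        (Y.submatrix (S.1.orderEmbOfFin S.2) id).det := by
  classical
  have h1 : (X * Y).det = ∑ r : Fin k → Fin p, (∏ i, X i (r i)) * (Y.submatrix r id).det := by
    have : X * Y = fun i => ∑ j, X i j • Y j := by
      funext i l
      simp [Matrix.mul_apply, Finset.sum_apply]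
    rw [this]
    change (Matrix.detRowAlternating (R := ℝ) (n := Fin k)).toMultilinearMap _ = _
    rw [MultilinearMap.map_sum]
    refine Finset.sum_congr rfl fun r _ => ?_
    rw [MultilinearMap.map_smul_univ, smul_eq_mul]
    rfl
  rw [h1]
  have h2 : ∀ S : {s : Finset (Fin p) // s.card = k},
      (X.submatrix id (S.1.orderEmbOfFin S.2)).det *
        (Y.submatrix (S.1.orderEmbOfFin S.2) id).det =
      ∑ σ : Equiv.Perm (Fin k), (∏ i, X i (S.1.orderEmbOfFin S.2 (σ i))) *
        (Y.submatrix (S.1.orderEmbOfFin S.2 ∘ σ) id).det := by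
    intro S
    rw [← Matrix.det_transpose, Matrix.det_apply', Finset.sum_mul]
    refine Finset.sum_congr rfl fun σ _ => ?_
    have := Matrix.det_permute σ (Y.submatrix (S.1.orderEmbOfFin S.2) id)
    rw [Matrix.submatrix_submatrix] at this
    simp only [Function.comp_id] at this
    rw [this]
    simp only [Matrix.transpose_apply, Matrix.submatrix_apply, id]
    ring
  simp_rw [h2]
  rw [← Fintype.sum_sigma' (fun (S : {s : Finset (Fin p) // s.card = k})
    (σ : Equiv.Perm (Fin k)) => (∏ i, X i (S.1.orderEmbOfFin S.2 (σ i))) *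
        (Y.submatrix (S.1.orderEmbOfFin S.2 ∘ σ) id).det)]
  symm
  refine Finset.sum_of_injOn (fun x => x.1.1.orderEmbOfFin x.1.2 ∘ x.2) ?_ (by simp) ?_ ?_
  · rintro ⟨⟨S, hS⟩, σ⟩ _ ⟨⟨T, hT⟩, τ⟩ _ h
    simp only at h
    have hr : ∀ (S : Finset (Fin p)) (hS : S.card = k) (σ : Equiv.Perm (Fin k)),
        Set.range (S.orderEmbOfFin hS ∘ σ) = (S : Set (Fin p)) := by
      intro S hS σ
      rw [EquivLike.range_comp, Finset.range_orderEmbOfFin]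
    have hST : S = T := by
      have := hr S hS σ
      rw [h, hr T hT τ] at this
      exact_mod_cast this.symm
    subst hST
    have : σ = τ := by
      ext i
      have := congrFun h i
      simp only [Function.comp_apply] at this
      rw [(S.orderEmbOfFin hS).injective this]
    rw [this]
  · intro r _ hr
    by_cases hinj : Function.Injective r
    · exfalso
      apply hr
      have hc : (Finset.univ.image r).card = k := by
        rw [Finset.card_image_of_injective _ hinj]; simp
      set S := Finset.univ.image r with hSdef
      have hmem : ∀ i, r i ∈ S := fun i => by simp [hSdef]
      let g : Fin k → Fin k := fun i => (S.orderIsoOfFin hc).symm ⟨r i, hmem i⟩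
      have hg : Function.Injective g := by
        intro i j hij
        have := (S.orderIsoOfFin hc).symm.injective hij
        exact hinj (by simpa using this)
      let σ : Equiv.Perm (Fin k) := Equiv.ofBijective g (Finite.injective_iff_bijective.1 hg)
      refine ⟨⟨⟨S, hc⟩, σ⟩, by simp, ?_⟩
      funext i
      simp only [Function.comp_apply]
      change ((S.orderIsoOfFin hc) ((S.orderIsoOfFin hc).symm ⟨r i, hmem i⟩) : Fin p) = r i
      simp
    · rw [Function.Injective] at hinj
      push Not at hinj
      obtain ⟨i, j, hij, hne⟩ := hinj
      rw [Matrix.det_zero_of_row_eq hne (by funext l; simp [hij]), mul_zero]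
  · intro x _
    rfl

lemma compound_mul {n p m : ℕ} (k : ℕ) (A : Matrix (Fin n) (Fin p) ℝ)
    (B : Matrix (Fin p) (Fin m) ℝ) : compound k (A * B) = compound k A * compound k B := by
  ext I J
  rw [Matrix.mul_apply]
  have := cauchy_binet_aux (A.submatrix (I.1.orderEmbOfFin I.2) id)
    (B.submatrix id (J.1.orderEmbOfFin J.2))
  exact this

lemma compound_transpose {n m : ℕ} (k : ℕ) (A : Matrix (Fin n) (Fin m) ℝ) :
    compound k Aᵀ = (compound k A)ᵀ := by
  ext I J
  exact Matrix.det_transpose (Matrix.of fun a b : Fin k =>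
    A (J.1.orderEmbOfFin J.2 a) (I.1.orderEmbOfFin I.2 b))

lemma compound_diagonal {n : ℕ} (k : ℕ) (d : Fin n → ℝ) :
    compound k (Matrix.diagonal d) = Matrix.diagonal (fun S => ∏ i ∈ S.1, d i) := by
  ext I J
  by_cases h : I = J
  · subst h
    rw [Matrix.diagonal_apply_eq]
    have : (Matrix.of fun a b : Fin k => (Matrix.diagonal d)
        (I.1.orderEmbOfFin I.2 a) (I.1.orderEmbOfFin I.2 b)) =
        Matrix.diagonal (fun a => d (I.1.orderEmbOfFin I.2 a)) := by
      ext a b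
      simp [Matrix.diagonal_apply]
    rw [compound, this, Matrix.det_diagonal]
    conv_rhs => rw [← Finset.image_orderEmbOfFin_univ I.1 I.2]
    rw [Finset.prod_image (fun a _ b _ hab => (I.1.orderEmbOfFin I.2).injective hab)]
  · rw [Matrix.diagonal_apply_ne _ h]
    have : ∃ x ∈ I.1, x ∉ J.1 := by
      by_contra hcon
      push Not at hcon
      exact h (Subtype.ext (Finset.eq_of_subset_of_card_le hcon (by rw [I.2, J.2])))
    obtain ⟨x, hx, hxJ⟩ := this
    rw [← Finset.mem_coe, ← Finset.range_orderEmbOfFin I.1 I.2] at hx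
    obtain ⟨a, rfl⟩ := hx
    refine Matrix.det_eq_zero_of_row_eq_zero a fun b => ?_
    rw [Matrix.of_apply, Matrix.diagonal_apply_ne]
    intro heq
    exact hxJ (heq ▸ Finset.orderEmbOfFin_mem J.1 J.2 b)

lemma compound_one {n : ℕ} (k : ℕ) : compound k (1 : Matrix (Fin n) (Fin n) ℝ) = 1 := by
  rw [← Matrix.diagonal_one, compound_diagonal]
  simp

lemma ae_ne_zero_of_analytic {E : Type*} [NormedAddCommGroup E] [NormedSpace ℝ E]
    [FiniteDimensional ℝ E] [MeasurableSpace E] [BorelSpace E] (μ : Measure E)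
    [μ.IsAddHaarMeasure] (f : E → ℝ) (hf : ∀ x, AnalyticAt ℝ f x) (a : E) (ha : f a ≠ 0) :
    ∀ᵐ x ∂μ, f x ≠ 0 := by
  have hc : Continuous f := continuous_iff_continuousAt.2 fun x => (hf x).continuousAt
  have hmeas : MeasurableSet {z : E × ℝ | f (z.2 • z.1 + (1 - z.2) • a) ≠ 0} := by
    have : IsOpen {z : E × ℝ | f (z.2 • z.1 + (1 - z.2) • a) ≠ 0} :=
      isOpen_ne_fun (by fun_prop) continuous_const
    exact this.measurableSet
  have h1 : ∀ᵐ x ∂μ, ∀ᵐ t : ℝ, f (t • x + (1 - t) • a) ≠ 0 := by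
    refine Filter.Eventually.of_forall fun x => ?_
    have han : AnalyticOnNhd ℝ (fun t : ℝ => f (t • x + (1 - t) • a)) Set.univ := by
      intro t _
      exact (hf _).fun_comp (f := fun t : ℝ => t • x + (1 - t) • a) (by fun_prop)
    have h2 := han.preimage_zero_mem_codiscrete (x := 0) (by simpa using ha)
    have h3 := ae_restrict_le_codiscreteWithin (μ := (volume : Measure ℝ)) MeasurableSet.univ h2
    rw [Measure.restrict_univ] at h3
    exact h3
  rw [Measure.ae_ae_comm (p := fun (x : E) (t : ℝ) => f (t • x + (1 - t) • a) ≠ 0) hmeas] at h1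
  have h0 : ∀ᵐ t : ℝ, t ≠ 0 := by simp [ae_iff]
  obtain ⟨t, ht, ht0⟩ := (h1.and h0).exists
  rw [ae_iff] at ht ⊢
  have key := Measure.addHaar_preimage_smul μ ht0
    ((fun y => y + (1 - t) • a) ⁻¹' {x | ¬ f x ≠ 0})
  rw [measure_preimage_add_right] at key
  have : ((t • ·) ⁻¹' ((fun y => y + (1 - t) • a) ⁻¹' {x | ¬ f x ≠ 0})) =
      {x | ¬ f (t • x + (1 - t) • a) ≠ 0} := rfl
  rw [this, ht] at key
  have h4 := key.symm
  rw [mul_eq_zero] at h4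
  refine h4.resolve_left ?_
  rw [ENNReal.ofReal_eq_zero, not_le]
  positivity

lemma exists_factor {n m : ℕ} (A : Matrix (Fin n) (Fin m) ℝ) :
    ∃ (r : ℕ) (U : Matrix (Fin n) (Fin r) ℝ) (V : Matrix (Fin r) (Fin m) ℝ)
      (L : Matrix (Fin r) (Fin n) ℝ), r ≤ n ∧ A = U * V ∧ V * Vᵀ = 1 ∧ L * U = 1 := by
  let row : Fin n → EuclideanSpace ℝ (Fin m) := fun i => WithLp.toLp 2 (A i)
  let W := Submodule.span ℝ (Set.range row)
  let b := stdOrthonormalBasis ℝ W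
  let V : Matrix (Fin (Module.finrank ℝ W)) (Fin m) ℝ :=
    fun j l => (b j : EuclideanSpace ℝ (Fin m)) l
  have hVV : V * Vᵀ = 1 := by
    ext i j
    have h := orthonormal_iff_ite.1 b.orthonormal j i
    rw [Matrix.mul_apply, Matrix.one_apply]
    rw [Submodule.coe_inner, PiLp.inner_apply] at h
    simp only [RCLike.inner_apply, conj_trivial] at h
    refine Eq.trans h ?_
    simp only [eq_comm]
  let U : Matrix (Fin n) (Fin (Module.finrank ℝ W)) ℝ := fun i j =>
    b.repr ⟨row i, Submodule.subset_span ⟨i, rfl⟩⟩ j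
  have hA : A = U * V := by
    ext i l
    have h := b.sum_repr ⟨row i, Submodule.subset_span ⟨i, rfl⟩⟩
    have h' := congrArg (fun w : W => (w : EuclideanSpace ℝ (Fin m)) l) h
    simp only [Submodule.coe_sum, Submodule.coe_smul, WithLp.ofLp_sum, Finset.sum_apply,
      WithLp.ofLp_smul, Pi.smul_apply, smul_eq_mul] at h'
    rw [Matrix.mul_apply]
    exact h'.symm
  have hL : ∀ j, ∃ c : Fin n → ℝ, ∑ i, c i • row i = (b j : EuclideanSpace ℝ (Fin m)) :=
    fun j => (Submodule.mem_span_range_iff_exists_fun ℝ).1 (b j).2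
  choose L hL using hL
  have hVL : V = Matrix.of L * A := by
    ext j l
    have h' := congrArg (fun w : EuclideanSpace ℝ (Fin m) => w l) (hL j)
    simp only [WithLp.ofLp_sum, Finset.sum_apply,
      WithLp.ofLp_smul, Pi.smul_apply, smul_eq_mul] at h'
    rw [Matrix.mul_apply]
    exact h'.symm
  refine ⟨Module.finrank ℝ W, U, V, Matrix.of L, ?_, hA, hVV, ?_⟩
  · exact (finrank_range_le_card (R := ℝ) row).trans_eq (Fintype.card_fin n)
  · have : V * Vᵀ = Matrix.of L * U * (V * Vᵀ) := by
      have h1 : V = Matrix.of L * (U * V) := by rw [← hA]; exact hVL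
      calc V * Vᵀ = (Matrix.of L * (U * V)) * Vᵀ := by rw [← h1]
        _ = _ := by simp only [Matrix.mul_assoc]
    rw [hVV, Matrix.mul_one] at this
    exact this.symm

/-- Krylov matrix of `T` with the all-ones row vector. -/
noncomputable def krylov {ι : Type*} [Fintype ι] [DecidableEq ι] {R : ℕ} (e : ι ≃ Fin R)
    (T : Matrix ι ι ℝ) : Matrix (Fin R) (Fin R) ℝ :=
  Matrix.of fun i j => ∑ l, (T ^ (i : ℕ)) l (e.symm j)

lemma krylov_diag {ι : Type*} [Fintype ι] [DecidableEq ι] {R : ℕ} (e : ι ≃ Fin R)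
    (c : ι → ℝ) (hc : Function.Injective c) : (krylov e (Matrix.diagonal c)).det ≠ 0 := by
  have : krylov e (Matrix.diagonal c) = (Matrix.vandermonde (c ∘ e.symm))ᵀ := by
    ext i j
    simp [krylov, Matrix.diagonal_pow, Matrix.diagonal_apply, Matrix.vandermonde_apply]
  rw [this, Matrix.det_transpose, Matrix.det_vandermonde_ne_zero_iff]
  exact hc.comp e.symm.injective

lemma krylov_inj {ι : Type*} [Fintype ι] [DecidableEq ι] {R : ℕ} (e : ι ≃ Fin R)
    (T : Matrix ι ι ℝ) (hT : (krylov e T).det ≠ 0) (μ : ℝ) (y : ι → ℝ)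
    (hy : T *ᵥ y = μ • y) (h0 : ∑ l, y l = 0) : y = 0 := by
  have hp : ∀ i : ℕ, (T ^ i) *ᵥ y = μ ^ i • y := by
    intro i
    induction i with
    | zero => simp
    | succ i ih => rw [pow_succ, ← Matrix.mulVec_mulVec, hy, Matrix.mulVec_smul, ih, smul_smul,
        pow_succ, mul_comm]
  have hk : krylov e T *ᵥ (y ∘ e.symm) = 0 := by
    funext i
    have h1 : ∑ l, ((T ^ (i : ℕ)) *ᵥ y) l = 0 := by
      rw [hp]
      simp [← Finset.mul_sum, h0]
    rw [Pi.zero_apply, ← h1]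
    simp only [krylov, Matrix.mulVec, dotProduct, Matrix.of_apply, Function.comp_apply]
    rw [Finset.sum_comm]
    simp_rw [Finset.sum_mul]
    exact Equiv.sum_comp e.symm (fun x => ∑ l, (T ^ (i : ℕ)) l x * y x)
  have := Matrix.eq_zero_of_mulVec_eq_zero hT hk
  funext i
  simpa using congrFun this (e i)

lemma finrank_le_of_krylov {ι κ : Type*} [Fintype ι] [DecidableEq ι] [Fintype κ] [DecidableEq κ]
    {R : ℕ} (e : ι ≃ Fin R)
    (T : Matrix ι ι ℝ) (hT : (krylov e T).det ≠ 0) (C : Matrix ι κ ℝ) (hC : C * Cᵀ = 1)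
    (μ : ℝ) (hμ : μ ≠ 0) :
    Module.finrank ℝ (Module.End.eigenspace (Matrix.toLin' (Cᵀ * T * C)) μ) ≤ 1 := by
  let φ : (κ → ℝ) →ₗ[ℝ] ℝ := (∑ l, LinearMap.proj l) ∘ₗ Matrix.toLin' C
  have hφ : ∀ x, φ x = ∑ l, (C *ᵥ x) l := by
    intro x
    simp [φ]
  let ψ := φ ∘ₗ (Module.End.eigenspace (Matrix.toLin' (Cᵀ * T * C)) μ).subtype
  have hψ : Function.Injective ψ := by
    rw [injective_iff_map_eq_zero]
    rintro ⟨x, hx⟩ h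
    change φ x = 0 at h
    rw [hφ] at h
    rw [Module.End.mem_eigenspace_iff, Matrix.toLin'_apply] at hx
    have hTy : T *ᵥ (C *ᵥ x) = μ • (C *ᵥ x) := by
      rw [← Matrix.mulVec_smul, ← hx, Matrix.mulVec_mulVec, Matrix.mulVec_mulVec,
        ← Matrix.mul_assoc, ← Matrix.mul_assoc, hC, Matrix.one_mul]
    have hy := krylov_inj e T hT μ _ hTy h
    rw [← Matrix.mulVec_mulVec, hy, Matrix.mulVec_zero] at hx
    have : x = 0 := (smul_eq_zero.1 hx.symm).resolve_left hμ
    subst this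
    rfl
  simpa using LinearMap.finrank_le_finrank_of_injective hψ

lemma prod_inj {r : ℕ} {k : ℕ} : Function.Injective
    (fun S : {s : Finset (Fin r) // s.card = k} =>
      ∏ i ∈ S.1, ((2 : ℝ) ^ (2 ^ (i : ℕ)) * (2 : ℝ) ^ (2 ^ (i : ℕ)))) := by
  intro S T h
  simp only [Finset.prod_mul_distrib, Finset.prod_pow_eq_pow_sum] at h
  rw [← pow_add, ← pow_add] at h
  have h2 := pow_right_injective₀ (a := (2 : ℝ)) (by norm_num) (by norm_num) h
  have h3 : ∑ i ∈ S.1, 2 ^ (i : ℕ) = ∑ i ∈ T.1, 2 ^ (i : ℕ) := by omega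
  have h4 : S.1.map Fin.valEmbedding = T.1.map Fin.valEmbedding := by
    apply Finset.geomSum_injective (n := 2) le_rfl
    simpa using h3
  exact Subtype.ext (Finset.map_injective _ h4)

lemma analytic_mul {E ι κ τ : Type*} [NormedAddCommGroup E] [NormedSpace ℝ E] [Fintype κ]
    (F : E → Matrix ι κ ℝ) (G : E → Matrix κ τ ℝ) (x : E)
    (hF : ∀ i j, AnalyticAt ℝ (fun x => F x i j) x)
    (hG : ∀ i j, AnalyticAt ℝ (fun x => G x i j) x) (i j) :
    AnalyticAt ℝ (fun x => (F x * G x) i j) x := by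
  simp only [Matrix.mul_apply]
  exact Finset.analyticAt_fun_sum _ fun l _ => (hF i l).mul (hG l j)

lemma analytic_pow {E ι : Type*} [NormedAddCommGroup E] [NormedSpace ℝ E] [Fintype ι]
    [DecidableEq ι] (F : E → Matrix ι ι ℝ) (x : E)
    (hF : ∀ i j, AnalyticAt ℝ (fun x => F x i j) x) (p : ℕ) : ∀ i j,
    AnalyticAt ℝ (fun x => (F x ^ p) i j) x := by
  induction p with
  | zero => intro i j; simp only [pow_zero]; exact analyticAt_const
  | succ p ih => intro i j; simp only [pow_succ]; exact analytic_mul _ _ x ih hF i j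

lemma analytic_det {E ι : Type*} [NormedAddCommGroup E] [NormedSpace ℝ E] [Fintype ι]
    [DecidableEq ι] (F : E → Matrix ι ι ℝ) (x : E)
    (hF : ∀ i j, AnalyticAt ℝ (fun x => F x i j) x) :
    AnalyticAt ℝ (fun x => (F x).det) x := by
  simp only [Matrix.det_apply']
  exact Finset.analyticAt_fun_sum _ fun σ _ => analyticAt_const.mul
    (Finset.analyticAt_fun_prod _ fun i _ => hF _ _)

lemma analytic_main {n r k R : ℕ} (U : Matrix (Fin n) (Fin r) ℝ)
    (e : {s : Finset (Fin r) // s.card = k} ≃ Fin R) (x : Fin n → Fin n → ℝ) :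
    AnalyticAt ℝ (fun Q : Fin n → Fin n → ℝ =>
      (krylov e ((compound k (Matrix.of Q) * compound k U)ᵀ *
        (compound k (Matrix.of Q) * compound k U))).det) x := by
  have hQ : ∀ i j, AnalyticAt ℝ (fun Q : Fin n → Fin n → ℝ => Q i j) x := by
    intro i j
    exact ((ContinuousLinearMap.proj (R := ℝ) (φ := fun _ : Fin n => ℝ) j).comp
      (ContinuousLinearMap.proj (R := ℝ) (φ := fun _ : Fin n => Fin n → ℝ) i)).analyticAt x
  have hC : ∀ I J, AnalyticAt ℝ (fun Q : Fin n → Fin n → ℝ =>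
      (compound k (Matrix.of Q)) I J) x := by
    intro I J
    exact analytic_det _ x fun i j => hQ _ _
  have hB := analytic_mul (fun Q : Fin n → Fin n → ℝ => compound k (Matrix.of Q))
    (fun _ => compound k U) x hC (fun _ _ => analyticAt_const)
  have hT := analytic_mul (fun Q : Fin n → Fin n → ℝ =>
    (compound k (Matrix.of Q) * compound k U)ᵀ) _ x (fun i j => hB j i) hB
  refine analytic_det _ x fun i j => ?_
  simp only [krylov, Matrix.of_apply]
  exact Finset.analyticAt_fun_sum _ fun l _ => analytic_pow _ x hT _ _ _

lemma exists_good {n r k R : ℕ} (hrn : r ≤ n) (U : Matrix (Fin n) (Fin r) ℝ)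
    (L : Matrix (Fin r) (Fin n) ℝ) (hLU : L * U = 1)
    (e : {s : Finset (Fin r) // s.card = k} ≃ Fin R) :
    ∃ Q : Fin n → Fin n → ℝ,
      (krylov e ((compound k (Matrix.of Q) * compound k U)ᵀ *
        (compound k (Matrix.of Q) * compound k U))).det ≠ 0 := by
  let P : Matrix (Fin n) (Fin r) ℝ :=
    (1 : Matrix (Fin n) (Fin n) ℝ).submatrix id (Fin.castLE hrn)
  have hP : Pᵀ * P = 1 := by
    ext i j
    simp [P, Matrix.mul_apply, Matrix.one_apply, eq_comm]
  let d : Fin r → ℝ := fun i => (2 : ℝ) ^ (2 ^ (i : ℕ))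
  refine ⟨P * Matrix.diagonal d * L, ?_⟩
  have h1 : compound k (Matrix.of (P * Matrix.diagonal d * L)) * compound k U =
      compound k (P * Matrix.diagonal d) := by
    rw [← compound_mul]
    congr 1
    change P * Matrix.diagonal d * L * U = _
    rw [Matrix.mul_assoc, hLU, Matrix.mul_one]
  have h2 : (P * Matrix.diagonal d)ᵀ * (P * Matrix.diagonal d) =
      Matrix.diagonal (fun i => d i * d i) := by
    rw [Matrix.transpose_mul, Matrix.mul_assoc, ← Matrix.mul_assoc Pᵀ, hP, Matrix.one_mul,
      Matrix.diagonal_transpose, Matrix.diagonal_mul_diagonal]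
  rw [h1, ← compound_transpose, ← compound_mul, h2, compound_diagonal]
  exact krylov_diag e _ prod_inj

/-- If `M` is compound-decomposable, then for (Lebesgue-)almost every `Q ∈ ℝ^{n×n}`
(identified with `ℝ^{n²}` via its entries), the nonzero singular values of `C_k(Q)·M`
are pairwise distinct; equivalently, every nonzero eigenvalue of the positive
semidefinite symmetric matrix `(C_k(Q)M)ᵀ(C_k(Q)M)` has multiplicity one. -/
theorem stmt_12 {n m k : ℕ} (hk1 : 1 ≤ k) (hkn : k ≤ n) (hkm : k ≤ m)
    (M : Matrix {s : Finset (Fin n) // s.card = k} {t : Finset (Fin m) // t.card = k} ℝ)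
    (hM : ∃ A : Matrix (Fin n) (Fin m) ℝ, compound k A = M) :
    ∀ᵐ Q : Fin n → Fin n → ℝ ∂volume, ∀ μ : ℝ, μ ≠ 0 →
      Module.finrank ℝ
        (Module.End.eigenspace
          (Matrix.toLin'
            ((compound k (Matrix.of Q) * M)ᵀ * (compound k (Matrix.of Q) * M))) μ)
        ≤ 1 := by
  obtain ⟨A, rfl⟩ := hM
  obtain ⟨r, U, V, L, hrn, hA, hVV, hLU⟩ := exists_factor A
  let e := Fintype.equivFin {s : Finset (Fin r) // s.card = k}
  obtain ⟨Q₀, hQ₀⟩ := exists_good hrn U L hLU e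
  have hae := ae_ne_zero_of_analytic (volume : Measure (Fin n → Fin n → ℝ)) _
    (analytic_main U e) Q₀ hQ₀
  have hC : compound k V * (compound k V)ᵀ = 1 := by
    rw [← compound_transpose, ← compound_mul, hVV, compound_one]
  filter_upwards [hae] with Q hQ μ hμ
  have hN : (compound k (Matrix.of Q) * compound k A)ᵀ * (compound k (Matrix.of Q) * compound k A)
      = (compound k V)ᵀ * ((compound k (Matrix.of Q) * compound k U)ᵀ *
        (compound k (Matrix.of Q) * compound k U)) * compound k V := by
    rw [hA, compound_mul]
    simp only [Matrix.transpose_mul, Matrix.mul_assoc]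
  rw [hN]
  exact finrank_le_of_krylov e _ hQ _ hC μ hμ
end

section
/- Let A ∈ ℝ^{n×m} with rank(A) = r, and let A = V Σ Wᵀ be a reduced singular value decomposition: V ∈ ℝ^{n×r} and W ∈ ℝ^{m×r} satisfy VᵀV = WᵀW = I_r, and Σ ∈ ℝ^{r×r} is diagonal with positive diagonal entries. Let 1 ≤ k ≤ r, set M = C_k(A), and let M = L S Rᵀ be a reduced singular value decomposition of M (L ∈ ℝ^{C(n,k)×C(r,k)} and R ∈ ℝ^{C(m,k)×C(r,k)} with orthonormal columns, S ∈ ℝ^{C(r,k)×C(r,k)} diagonal with positive entries) such that the diagonal entries of S are pairwise distinct. Then there exist a permutation matrix P ∈ {0,1}^{C(r,k)×C(r,k)} and a diagonal matrix D with diagonal entries in {1,−1} such that L = C_k(V) P D and R = C_k(W) P D. -/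
open Matrix

theorem cp_sum_fun {n k : ℕ} (X : Matrix (Fin k) (Fin n) ℝ) (Y : Matrix (Fin n) (Fin k) ℝ) :
    (X * Y).det = ∑ f : Fin k → Fin n, (∏ i, X i (f i)) * (Y.submatrix f id).det := by
  have h1 : (X * Y).det = Matrix.detRowAlternating (fun i => ∑ j, X i j • Y j) := by
    change _ = Matrix.det _
    congr 1
    ext i b
    simp [Matrix.mul_apply]
  rw [h1]
  have := (Matrix.detRowAlternating (n := Fin k) (R := ℝ)).toMultilinearMap.map_sum
    (fun i (j : Fin n) => X i j • Y j)
  refine this.trans (Finset.sum_congr rfl fun f _ => ?_)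
  have h2 := (Matrix.detRowAlternating (n := Fin k) (R := ℝ)).toMultilinearMap.map_smul_univ
    (fun i => X i (f i)) (fun i => Y (f i))
  exact h2

theorem cp_cauchy {n k : ℕ} (X : Matrix (Fin k) (Fin n) ℝ) (Y : Matrix (Fin n) (Fin k) ℝ) :
    (X * Y).det = ∑ S : {s : Finset (Fin n) // s.card = k},
      (X.submatrix id (S.1.orderEmbOfFin S.2)).det *
      (Y.submatrix (S.1.orderEmbOfFin S.2) id).det := by
  rw [cp_sum_fun]
  have h1 : ∀ S : {s : Finset (Fin n) // s.card = k},
      (X.submatrix id (S.1.orderEmbOfFin S.2)).det *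
      (Y.submatrix (S.1.orderEmbOfFin S.2) id).det =
      ∑ p : Equiv.Perm (Fin k), (∏ i, X i (S.1.orderEmbOfFin S.2 (p i))) *
        (Y.submatrix (fun i => S.1.orderEmbOfFin S.2 (p i)) id).det := by
    intro S
    rw [← Matrix.det_transpose, Matrix.det_apply', Finset.sum_mul]
    refine Finset.sum_congr rfl fun p _ => ?_
    have : (Y.submatrix (fun i => S.1.orderEmbOfFin S.2 (p i)) id) =
      (Y.submatrix (S.1.orderEmbOfFin S.2) id).submatrix p id := by ext; simp
    rw [this, Matrix.det_permute]
    simp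
    ring
  simp_rw [h1]
  rw [← Fintype.sum_prod_type' (f := fun (S : {s : Finset (Fin n) // s.card = k})
    (p : Equiv.Perm (Fin k)) => (∏ i, X i (S.1.orderEmbOfFin S.2 (p i))) *
        (Y.submatrix (fun i => S.1.orderEmbOfFin S.2 (p i)) id).det)]
  symm
  refine Finset.sum_of_injOn (fun q i => q.1.1.orderEmbOfFin q.1.2 (q.2 i)) ?_ ?_ ?_ ?_
  · rintro ⟨S, p⟩ _ ⟨T, q⟩ _ h
    simp only at h
    have hST : S = T := by
      apply Subtype.ext
      have e1 := Finset.range_orderEmbOfFin S.1 S.2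
      have e2 := Finset.range_orderEmbOfFin T.1 T.2
      have e3 : Set.range (fun i => S.1.orderEmbOfFin S.2 (p i)) =
        Set.range (fun i => T.1.orderEmbOfFin T.2 (q i)) := by rw [h]
      have e4 := p.surjective.range_comp (S.1.orderEmbOfFin S.2)
      have e5 := q.surjective.range_comp (T.1.orderEmbOfFin T.2)
      apply Finset.coe_injective
      rw [← e1, ← e2, ← e4, ← e5]
      exact e3
    subst hST
    congr 1
    apply Equiv.ext
    intro i
    have := congrFun h i
    simpa using this
  · simp
  · intro f _ hf
    by_cases hi : Function.Injective f
    · exfalso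
      apply hf
      have hc : (Finset.univ.image f).card = k := by
        rw [Finset.card_image_of_injective _ hi]; simp
      let S : {s : Finset (Fin n) // s.card = k} := ⟨Finset.univ.image f, hc⟩
      have hr : ∀ i, ∃ j, S.1.orderEmbOfFin S.2 j = f i := by
        intro i
        have : f i ∈ Set.range (S.1.orderEmbOfFin S.2) := by
          rw [Finset.range_orderEmbOfFin]; simp [S]
        exact this
      choose g hg using hr
      have gi : Function.Injective g := by
        intro a b hab
        apply hi
        rw [← hg, ← hg, hab]
      refine ⟨(S, Equiv.ofBijective g (Finite.injective_iff_bijective.mp gi)), by simp, ?_⟩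
      funext i
      exact hg i
    · simp only [Function.Injective, not_forall] at hi
      obtain ⟨a, b, hab, hne⟩ := hi
      rw [Matrix.det_zero_of_row_eq hne, mul_zero]
      ext c
      simp [hab]
  · intro q _
    rfl

theorem cp_mul {n m l k : ℕ} (A : Matrix (Fin n) (Fin m) ℝ) (B : Matrix (Fin m) (Fin l) ℝ) :
    compound k (A * B) = compound k A * compound k B := by
  ext I J
  rw [Matrix.mul_apply]
  have := cp_cauchy (A.submatrix (I.1.orderEmbOfFin I.2) id) (B.submatrix id (J.1.orderEmbOfFin J.2))
  exact this

theorem cp_transpose {n m k : ℕ} (A : Matrix (Fin n) (Fin m) ℝ) :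
    compound k Aᵀ = (compound k A)ᵀ := by
  ext I J
  exact Matrix.det_transpose (A.submatrix (J.1.orderEmbOfFin J.2) (I.1.orderEmbOfFin I.2))

theorem cp_diag {n k : ℕ} (σ : Fin n → ℝ) :
    compound k (Matrix.diagonal σ) =
      Matrix.diagonal (fun I => ∏ a, σ (I.1.orderEmbOfFin I.2 a)) := by
  ext I J
  by_cases h : I = J
  · subst h
    rw [Matrix.diagonal_apply_eq, ← Matrix.det_diagonal]
    unfold compound
    congr 1
    ext a b
    simp [Matrix.diagonal_apply]
  · rw [Matrix.diagonal_apply_ne _ h]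
    have : ∃ x ∈ I.1, x ∉ J.1 := by
      by_contra! hc
      exact h (Subtype.ext (Finset.eq_of_subset_of_card_le hc (by rw [I.2, J.2])))
    obtain ⟨x, hx, hxJ⟩ := this
    have hx' : x ∈ Set.range (I.1.orderEmbOfFin I.2) := by
      rw [Finset.range_orderEmbOfFin]; exact hx
    obtain ⟨a, rfl⟩ := hx'
    apply Matrix.det_eq_zero_of_row_eq_zero a
    intro b
    simp only [Matrix.of_apply]
    apply Matrix.diagonal_apply_ne
    intro hab
    exact hxJ (hab ▸ Finset.orderEmbOfFin_mem _ _ _)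

theorem cp_one {n k : ℕ} : compound k (1 : Matrix (Fin n) (Fin n) ℝ) = 1 := by
  rw [← Matrix.diagonal_one, cp_diag]
  simp

theorem cp_svd {α β ι : Type*} [Fintype α] [Fintype β] [Fintype ι] [DecidableEq ι]
    (U L : Matrix α ι ℝ) (Z R : Matrix β ι ℝ) (t s : ι → ℝ)
    (hU : Uᵀ * U = 1) (hZ : Zᵀ * Z = 1) (hL : Lᵀ * L = 1) (hR : Rᵀ * R = 1)
    (ht : ∀ i, 0 < t i) (hs : ∀ i, 0 < s i) (hd : Function.Injective s)
    (h : U * diagonal t * Zᵀ = L * diagonal s * Rᵀ) :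
    ∃ (P : Equiv.Perm ι) (d : ι → ℝ), (∀ i, d i = 1 ∨ d i = -1) ∧
      L = (U.submatrix id P.symm) * diagonal d ∧ R = (Z.submatrix id P.symm) * diagonal d := by
  have h' : Z * diagonal t * Uᵀ = R * diagonal s * Lᵀ := by
    have := congrArg Matrix.transpose h
    simpa [Matrix.transpose_mul, Matrix.mul_assoc] using this
  set Q := Uᵀ * L with hQ
  set N := Zᵀ * R with hN
  have hss : diagonal s * diagonal (fun i => (s i)⁻¹) = (1 : Matrix ι ι ℝ) := by
    rw [Matrix.diagonal_mul_diagonal, ← Matrix.diagonal_one]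
    congr 1
    ext i
    exact mul_inv_cancel₀ (hs i).ne'
  have e1 : L * diagonal s = U * (diagonal t * N) := by
    calc L * diagonal s = L * diagonal s * (Rᵀ * R) := by rw [hR, Matrix.mul_one]
      _ = (L * diagonal s * Rᵀ) * R := by simp only [Matrix.mul_assoc]
      _ = _ := by rw [← h, hN]; simp only [Matrix.mul_assoc]
  have e2 : R * diagonal s = Z * (diagonal t * Q) := by
    calc R * diagonal s = R * diagonal s * (Lᵀ * L) := by rw [hL, Matrix.mul_one]
      _ = (R * diagonal s * Lᵀ) * L := by simp only [Matrix.mul_assoc]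
      _ = _ := by rw [← h', hQ]; simp only [Matrix.mul_assoc]
  have f1 : Q * diagonal s = diagonal t * N := by
    rw [hQ, Matrix.mul_assoc, e1, ← Matrix.mul_assoc, hU, Matrix.one_mul]
  have f2 : N * diagonal s = diagonal t * Q := by
    rw [hN, Matrix.mul_assoc, e2, ← Matrix.mul_assoc, hZ, Matrix.one_mul]
  have g1 : L = U * Q := by
    calc L = L * diagonal s * diagonal (fun i => (s i)⁻¹) := by
          rw [Matrix.mul_assoc, hss, Matrix.mul_one]
      _ = U * (Q * (diagonal s * diagonal (fun i => (s i)⁻¹))) := by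
          rw [e1, ← f1]; simp only [Matrix.mul_assoc]
      _ = _ := by rw [hss, Matrix.mul_one]
  have g2 : R = Z * N := by
    calc R = R * diagonal s * diagonal (fun i => (s i)⁻¹) := by
          rw [Matrix.mul_assoc, hss, Matrix.mul_one]
      _ = Z * (N * (diagonal s * diagonal (fun i => (s i)⁻¹))) := by
          rw [e2, ← f2]; simp only [Matrix.mul_assoc]
      _ = _ := by rw [hss, Matrix.mul_one]
  clear_value Q N
  have QQ : Qᵀ * Q = 1 := by
    rw [← hL, g1, Matrix.transpose_mul, Matrix.mul_assoc, ← Matrix.mul_assoc Uᵀ, hU, Matrix.one_mul]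
  have k1 : ∀ i j, Q i j * s j = t i * N i j := fun i j => by
    have := congrFun (congrFun f1 i) j
    simpa using this
  have k2 : ∀ i j, N i j * s j = t i * Q i j := fun i j => by
    have := congrFun (congrFun f2 i) j
    simpa using this
  have NQ : N = Q := by
    ext i j
    have h3 : (N i j - Q i j) * (s j + t i) = 0 := by linarith [k1 i j, k2 i j]
    have := (mul_eq_zero.mp h3).resolve_right (add_pos (hs j) (ht i)).ne'
    linarith
  subst NQ
  have ts : ∀ i j, N i j ≠ 0 → t i = s j := fun i j hne => by
    have := k1 i j
    rw [mul_comm] at this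
    exact (mul_right_cancel₀ hne this).symm
  have dg : ∀ j, ∑ i, N i j * N i j = 1 := fun j => by
    have := congrFun (congrFun QQ j) j
    simpa [Matrix.mul_apply] using this
  have ex : ∀ j, ∃ i, N i j ≠ 0 := by
    intro j
    by_contra! hc
    have := dg j
    simp [hc] at this
  choose f hf using ex
  have fi : Function.Injective f := by
    intro a b hab
    apply hd
    rw [← ts _ _ (hf a), ← ts _ _ (hf b), hab]
  have fb := Finite.injective_iff_bijective.mp fi
  have z : ∀ i j, i ≠ f j → N i j = 0 := by
    intro i j hij
    by_contra hne
    obtain ⟨j', rfl⟩ := fb.2 i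
    apply hij
    have : s j = s j' := by rw [← ts _ _ hne, ← ts _ _ (hf j')]
    rw [hd this]
  refine ⟨(Equiv.ofBijective f fb).symm, fun j => N (f j) j, ?_, ?_, ?_⟩
  · intro j
    have := dg j
    rw [Finset.sum_eq_single (f j) (fun i _ hi => by simp [z i j hi]) (by simp)] at this
    exact mul_self_eq_one_iff.mp this
  · rw [g1]
    ext a j
    rw [Matrix.mul_apply,
      Finset.sum_eq_single (f j) (fun i _ hi => by simp [z i j hi]) (by simp)]
    simp
  · rw [g2]
    ext a j
    rw [Matrix.mul_apply,
      Finset.sum_eq_single (f j) (fun i _ hi => by simp [z i j hi]) (by simp)]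
    simp

/-- Let `A = V Σ Wᵀ` be a reduced SVD of `A` of rank `r`, `1 ≤ k ≤ r`, and let
`M = C_k(A) = L S Rᵀ` be a reduced SVD of `M` whose (positive) singular values on the
diagonal of `S` are pairwise distinct. Then there exist a permutation `P` and a diagonal
sign matrix `D` (entries in `{1,-1}`) with `L = C_k(V) P D` and `R = C_k(W) P D`; here
`C_k(V).submatrix id P.symm * diagonal d` is the matrix `C_k(V) P D`, with `P` acting as
the corresponding column-permutation matrix. -/
theorem stmt_13 {n m r k : ℕ} (A : Matrix (Fin n) (Fin m) ℝ)
    (hA : A.rank = r) (hk1 : 1 ≤ k) (hkr : k ≤ r)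
    (V : Matrix (Fin n) (Fin r) ℝ) (W : Matrix (Fin m) (Fin r) ℝ) (σ : Fin r → ℝ)
    (hV : Vᵀ * V = 1) (hW : Wᵀ * W = 1) (hσ : ∀ i, 0 < σ i)
    (hSVD : A = V * Matrix.diagonal σ * Wᵀ)
    (L : Matrix {s : Finset (Fin n) // s.card = k} {s : Finset (Fin r) // s.card = k} ℝ)
    (R : Matrix {t : Finset (Fin m) // t.card = k} {s : Finset (Fin r) // s.card = k} ℝ)
    (s : {s : Finset (Fin r) // s.card = k} → ℝ)
    (hL : Lᵀ * L = 1) (hR : Rᵀ * R = 1) (hs : ∀ i, 0 < s i)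
    (hdist : Function.Injective s)
    (hMSVD : compound k A = L * Matrix.diagonal s * Rᵀ) :
    ∃ (P : Equiv.Perm {s : Finset (Fin r) // s.card = k})
      (d : {s : Finset (Fin r) // s.card = k} → ℝ),
      (∀ i, d i = 1 ∨ d i = -1) ∧
      L = ((compound k V).submatrix id P.symm) * Matrix.diagonal d ∧
      R = ((compound k W).submatrix id P.symm) * Matrix.diagonal d := by
  have cV : (compound k V)ᵀ * compound k V = 1 := by
    rw [← cp_transpose, ← cp_mul, hV, cp_one]
  have cW : (compound k W)ᵀ * compound k W = 1 := by
    rw [← cp_transpose, ← cp_mul, hW, cp_one]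
  refine cp_svd (compound k V) L (compound k W) R
    (fun I => ∏ a, σ (I.1.orderEmbOfFin I.2 a)) s cV cW hL hR
    (fun I => Finset.prod_pos fun a _ => hσ _) hs hdist ?_
  rw [← hMSVD, hSVD, cp_mul, cp_mul, cp_transpose, cp_diag]
end

section
/- Let 1 ≤ k < n and let z ∈ ℝ^{C(n,k)}, with entries z_I indexed by the k-element subsets I of {1,…,n}, be nonzero and decomposable: there exist linearly independent u_1,…,u_k ∈ ℝ^n such that z_I = det(U_{I,·}) for every k-element subset I, where U = [u_1 ⋯ u_k] ∈ ℝ^{n×k} and U_{I,·} is the k×k submatrix of U with rows I. Define M_z ∈ ℝ^{C(n,k+1)×n}, with rows indexed by the (k+1)-element subsets I of {1,…,n} and columns by j ∈ {1,…,n}, by (M_z)_{I,j} = 0 if j ∉ I, and (M_z)_{I,j} = (−1)^{p−1} z_{I∖{j}} if j is the p-th smallest element of I. Then the kernel of M_z equals the column span of U, i.e., ker(M_z) = span{u_1,…,u_k}. -/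
/-- The wedge matrix `M_z` of a vector `z` indexed by the `k`-element subsets of
`{1,…,n}`: rows are indexed by `(k+1)`-element subsets `I`, columns by `j ∈ {1,…,n}`,
with `(M_z)_{I,j} = 0` if `j ∉ I` and `(M_z)_{I,j} = (-1)^{p-1} z_{I ∖ {j}}` if `j` is the
`p`-th smallest element of `I` (so `p - 1 = #{i ∈ I : i < j}`). -/
def wedgeMatrix {n k : ℕ} (z : {s : Finset (Fin n) // s.card = k} → ℝ) :
    Matrix {s : Finset (Fin n) // s.card = k + 1} (Fin n) ℝ :=
  fun I j =>
    if h : j ∈ I.1 then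
      (-1 : ℝ) ^ ((I.1.filter (fun i => i < j)).card)
        * z ⟨I.1.erase j, by
            rw [Finset.card_erase_of_mem h, I.2]; rfl⟩
    else 0

lemma exists_minor {n m : ℕ} (v : Fin m → (Fin n → ℝ)) (hv : LinearIndependent ℝ v) :
    ∃ I : {s : Finset (Fin n) // s.card = m},
      Matrix.det (Matrix.of fun a b : Fin m => v b (I.1.orderEmbOfFin I.2 a)) ≠ 0 := by
  classical
  obtain ⟨κ, a, ha, hsp, hli⟩ := exists_linearIndependent' ℝ (Matrix.of v).col
  haveI : Finite κ := Finite.of_injective a ha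
  cases nonempty_fintype κ
  have hr : (Matrix.of v).rank = m := by
    have := LinearIndependent.rank_matrix (M := Matrix.of v) hv
    simpa using this
  have hc : Fintype.card κ = m := by
    rw [linearIndependent_iff_card_eq_finrank_span.mp hli, Set.finrank, hsp,
      ← Matrix.rank_eq_finrank_span_cols, hr]
  refine ⟨⟨Finset.univ.image a, ?_⟩, ?_⟩
  · rw [Finset.card_image_of_injective _ ha, Finset.card_univ, hc]
  · generalize_proofs h
    have hmem : ∀ i : Fin m, ∃ j : κ, a j = (Finset.univ.image a).orderEmbOfFin h i := by
      intro i
      have := Finset.orderEmbOfFin_mem (Finset.univ.image a) h i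
      obtain ⟨j, _, hj⟩ := Finset.mem_image.1 this
      exact ⟨j, hj⟩
    choose g hg using hmem
    have hgi : Function.Injective g := by
      intro x y hxy
      apply ((Finset.univ.image a).orderEmbOfFin h).injective
      rw [← hg, ← hg, hxy]
    have h2 := hli.comp g hgi
    have h3 : LinearIndependent ℝ (Matrix.of fun x b : Fin m =>
        v b ((Finset.univ.image a).orderEmbOfFin h x)).row := by
      have h4 : (Matrix.of fun x b : Fin m =>
          v b ((Finset.univ.image a).orderEmbOfFin h x)).row = ((Matrix.of v).col ∘ a) ∘ g := by
        ext x b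
        change v b ((Finset.univ.image a).orderEmbOfFin h x) = v b (a (g x))
        rw [hg]
      rw [h4]
      exact h2
    rw [Matrix.linearIndependent_rows_iff_isUnit, Matrix.isUnit_iff_isUnit_det] at h3
    exact h3.ne_zero

lemma li_of_minor {n m : ℕ} (v : Fin m → (Fin n → ℝ)) (e : Fin m → Fin n)
    (h : Matrix.det (Matrix.of fun a b : Fin m => v b (e a)) ≠ 0) :
    LinearIndependent ℝ v := by
  have h1 : IsUnit (Matrix.of fun a b : Fin m => v b (e a)) := by
    rw [Matrix.isUnit_iff_isUnit_det]; exact h.isUnit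
  rw [← Matrix.linearIndependent_cols_iff_isUnit] at h1
  exact LinearIndependent.of_comp (LinearMap.funLeft ℝ ℝ e) h1

lemma wedge_mulVec {n k : ℕ}
    (z : {s : Finset (Fin n) // s.card = k} → ℝ)
    (u : Fin k → (Fin n → ℝ))
    (hz : ∀ I : {s : Finset (Fin n) // s.card = k},
      z I = Matrix.det (Matrix.of fun a b : Fin k => u b (I.1.orderEmbOfFin I.2 a)))
    (x : Fin n → ℝ) (I : {s : Finset (Fin n) // s.card = k + 1}) :
    Matrix.mulVec (wedgeMatrix z) x I = Matrix.det (Matrix.of fun a b : Fin (k+1) =>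
      (Fin.cons x u : Fin (k+1) → (Fin n → ℝ)) b (I.1.orderEmbOfFin I.2 a)) := by
  classical
  rw [Matrix.det_succ_column_zero]
  set e := I.1.orderEmbOfFin I.2 with he
  have himg : Finset.univ.image e = I.1 := by
    simp [he]
  have h0 : Matrix.mulVec (wedgeMatrix z) x I = ∑ j ∈ I.1, wedgeMatrix z I j * x j := by
    rw [Matrix.mulVec, dotProduct]
    symm
    apply Finset.sum_subset (Finset.subset_univ _)
    intro j _ hj
    simp [wedgeMatrix, hj]
  have h1 : ∑ j ∈ I.1, wedgeMatrix z I j * x j = ∑ i, wedgeMatrix z I (e i) * x (e i) := by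
    conv_lhs => rw [← himg]
    rw [Finset.sum_image (fun a _ b _ h => e.injective h)]
  rw [h0, h1]
  refine Finset.sum_congr rfl fun i _ => ?_
  have hm : e i ∈ I.1 := Finset.orderEmbOfFin_mem _ _ _
  have hcard : (I.1.filter (fun j => j < e i)).card = (i : ℕ) := by
    have : I.1.filter (fun j => j < e i) = (Finset.Iio i).image e := by
      conv_lhs => rw [← himg]
      ext j
      simp only [Finset.mem_filter, Finset.mem_image, Finset.mem_univ, true_and, Finset.mem_Iio]
      constructor
      · rintro ⟨⟨a, rfl⟩, h⟩
        exact ⟨a, e.lt_iff_lt.1 h, rfl⟩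
      · rintro ⟨a, h, rfl⟩
        exact ⟨⟨a, rfl⟩, e.lt_iff_lt.2 h⟩
    rw [this, Finset.card_image_of_injective _ e.injective, Fin.card_Iio]
  have hc : (I.1.erase (e i)).card = k := by
    rw [Finset.card_erase_of_mem hm, I.2]; rfl
  have hu : (fun a => e (i.succAbove a)) = (I.1.erase (e i)).orderEmbOfFin hc := by
    apply Finset.orderEmbOfFin_unique
    · intro a
      refine Finset.mem_erase.2 ⟨fun h => Fin.succAbove_ne i a (e.injective h),
        Finset.orderEmbOfFin_mem _ _ _⟩
    · exact e.strictMono.comp (Fin.strictMono_succAbove i)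
  have hw : wedgeMatrix z I (e i) = (-1 : ℝ) ^ (i : ℕ) * z ⟨I.1.erase (e i), hc⟩ := by
    simp only [wedgeMatrix, hm, dif_pos, hcard]
  rw [hw, hz]
  have hd : (Matrix.of fun a b : Fin k => u b ((I.1.erase (e i)).orderEmbOfFin hc a)) =
    (Matrix.of fun a b : Fin (k+1) =>
      (Fin.cons x u : Fin (k+1) → (Fin n → ℝ)) b (e a)).submatrix i.succAbove Fin.succ := by
    ext a b
    have := congrFun hu a
    simp [← this]
  rw [← hd]
  simp only [Matrix.of_apply, Fin.cons_zero]
  ring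

/-- Let `1 ≤ k < n` and let `z` be the vector of Plücker coordinates
`z_I = det(U_{I,·})` of `k` linearly independent vectors `u_1,…,u_k ∈ ℝ^n`
(`U = [u_1 ⋯ u_k]`). Then the kernel of the wedge matrix `M_z` is `span{u_1,…,u_k}`. -/
theorem stmt_15 {n k : ℕ} (hk1 : 1 ≤ k) (hkn : k < n)
    (z : {s : Finset (Fin n) // s.card = k} → ℝ)
    (u : Fin k → (Fin n → ℝ)) (hu : LinearIndependent ℝ u)
    (hz : ∀ I : {s : Finset (Fin n) // s.card = k},
      z I = Matrix.det (Matrix.of fun a b : Fin k => u b (I.1.orderEmbOfFin I.2 a))) :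
    LinearMap.ker (Matrix.toLin' (wedgeMatrix z)) = Submodule.span ℝ (Set.range u) := by
  ext x
  rw [LinearMap.mem_ker, Matrix.toLin'_apply]
  have key : LinearIndependent ℝ (Fin.cons x u : Fin (k+1) → (Fin n → ℝ)) ↔
      x ∉ Submodule.span ℝ (Set.range u) := by
    rw [linearIndependent_finCons]
    exact ⟨fun h => h.2, fun h => ⟨hu, h⟩⟩
  constructor
  · intro h
    by_contra hx
    obtain ⟨I, hI⟩ := exists_minor _ (key.2 hx)
    apply hI
    rw [← wedge_mulVec z u hz x I, h]
    rfl
  · intro h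
    ext I
    rw [wedge_mulVec z u hz x I]
    by_contra hI
    exact key.1 (li_of_minor _ _ hI) h
end
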